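/- arXiv:1608.00216 — 2 statements merged into one kernel-verified Lean document; each statement's English description precedes it below -/
import Mathlib

section
/- Let T̃ : ℝ → ℝ be a concave function and let (T̃_i)_{i≥1} be a sequence of differentiable concave functions from ℝ to ℝ converging pointwise to T̃. Then the Legendre transforms T̃_i^* converge pointwise to T̃^* at every point of the interior of the domain of T̃^*. -/
open Filter Set

theorem ConvexOn.extrapolation_le {f : ℝ → ℝ} (hf : ConvexOn ℝ Set.univ f) (x q : ℝ) :
    (1 + |q - x|) * f x - |q - x| * max (f (x - 1)) (f (x + 1)) ≤ f q := by
  have key : ∀ s y : ℝ, 0 ≤ s → q + s * y = (1 + s) * x →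
      (1 + s) * f x - s * f y ≤ f q := by
    intro s y hs h
    have hpos : 0 < 1 + s := by linarith
    have h1 := hf.2 (Set.mem_univ q) (Set.mem_univ y) (show 0 ≤ 1 / (1 + s) by positivity)
      (show 0 ≤ s / (1 + s) by positivity) (by field_simp)
    simp only [smul_eq_mul] at h1
    have hx : 1 / (1 + s) * q + s / (1 + s) * y = x := by
      field_simp
      linarith
    have hr : 1 / (1 + s) * f q + s / (1 + s) * f y = (f q + s * f y) / (1 + s) := by
      field_simp
    rw [hx, hr, le_div_iff₀ hpos] at h1
    linarith
  rcases le_total x q with h | h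
  · rw [abs_of_nonneg (sub_nonneg.2 h)]
    have h1 := key (q - x) (x - 1) (sub_nonneg.2 h) (by ring)
    have h2 := mul_le_mul_of_nonneg_left (le_max_left (f (x - 1)) (f (x + 1))) (sub_nonneg.2 h)
    linarith
  · rw [abs_of_nonpos (sub_nonpos.2 h)]
    have hs : 0 ≤ -(q - x) := by linarith
    have h1 := key (-(q - x)) (x + 1) hs (by ring)
    have h2 := mul_le_mul_of_nonneg_left (le_max_right (f (x - 1)) (f (x + 1))) hs
    linarith

theorem ConvexOn.eventually_nhds_prod_lt {ι : Type*} {l : Filter ι} {F : ι → ℝ → ℝ} {G : ℝ → ℝ}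
    (hF : ∀ i, ConvexOn ℝ Set.univ (F i)) (hFG : ∀ q, Tendsto (fun i => F i q) l (nhds (G q)))
    {c x : ℝ} (hc : c < G x) : ∀ᶠ p : ℝ × ι in nhds x ×ˢ l, c < F p.2 p.1 := by
  have hs : Tendsto (fun p : ℝ × ι => |p.1 - x|) (nhds x ×ˢ l) (nhds 0) := by
    have : Tendsto (fun q : ℝ => |q - x|) (nhds x) (nhds |x - x|) :=
      (by fun_prop : Continuous fun q : ℝ => |q - x|).tendsto x
    rw [sub_self, abs_zero] at this
    exact this.comp tendsto_fst
  have hpt : ∀ y, Tendsto (fun p : ℝ × ι => F p.2 y) (nhds x ×ˢ l) (nhds (G y)) :=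
    fun y => (hFG y).comp tendsto_snd
  have hlim := ((hs.const_add 1).mul (hpt x)).sub
    (hs.mul ((hpt (x - 1)).max (hpt (x + 1))))
  rw [add_zero, one_mul, zero_mul, sub_zero] at hlim
  filter_upwards [hlim.eventually_const_lt hc] with p hp
  exact hp.trans_le ((hF p.2).extrapolation_le x p.1)

theorem ConvexOn.le_of_notMem_Icc {f : ℝ → ℝ} (hf : ConvexOn ℝ Set.univ f) {a x b q : ℝ}
    (hax : a < x) (hxb : x < b) (ha : f x < f a) (hb : f x < f b) (hq : q ∉ Set.Icc a b) :
    f x ≤ f q := by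
  by_contra! h
  have hle : ∀ y ∈ segment ℝ q x, f y ≤ f x := fun y hy =>
    (hf.le_on_segment (Set.mem_univ _) (Set.mem_univ _) hy).trans (max_le h.le le_rfl)
  rw [Set.mem_Icc, not_and_or, not_le, not_le] at hq
  rcases hq with hq | hq
  · have := hle a (by rw [segment_eq_Icc (by linarith)]; exact ⟨hq.le, hax.le⟩)
    linarith
  · have := hle b (by rw [segment_symm, segment_eq_Icc (by linarith)]; exact ⟨hxb.le, hq.le⟩)
    linarith

theorem ConvexOn.eventually_forall_lt {ι : Type*} {l : Filter ι} {F : ι → ℝ → ℝ} {G : ℝ → ℝ}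
    (hF : ∀ i, ConvexOn ℝ Set.univ (F i)) (hFG : ∀ q, Tendsto (fun i => F i q) l (nhds (G q)))
    {a x b : ℝ} (hax : a < x) (hxb : x < b) (ha : G x < G a) (hb : G x < G b)
    {c : ℝ} (hc : ∀ q, c < G q) : ∀ᶠ i in l, ∀ q, c < F i q := by
  have hcompact : ∀ᶠ i in l, ∀ q ∈ Set.Icc a b, c < F i q := by
    have h : ∀ᶠ p : ℝ × ι in nhdsSet (Set.Icc a b) ×ˢ l, c < F p.2 p.1 := by
      rw [isCompact_Icc.nhdsSet_prod_eq_biSup]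
      simp only [Filter.eventually_iSup]
      exact fun q _ => ConvexOn.eventually_nhds_prod_lt hF hFG (hc q)
    obtain ⟨p, hp, r, hr, hpr⟩ := Filter.eventually_prod_iff.1 h
    filter_upwards [hr] with i hi q hq
    exact hpr (hp.self_of_nhdsSet q hq) hi
  filter_upwards [hcompact, (hFG x).eventually_const_lt (hc x), (hFG x).eventually_lt (hFG a) ha,
    (hFG x).eventually_lt (hFG b) hb] with i h1 h2 h3 h4 q
  by_cases hq : q ∈ Set.Icc a b
  · exact h1 q hq
  · exact h2.trans_le ((hF i).le_of_notMem_Icc hax hxb h3 h4 hq)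

theorem exists_lt_of_mem_interior_legendre_domain {T : ℝ → ℝ} {d : ℝ}
    (hd : d ∈ interior {d' : ℝ | BddBelow {y | ∃ q : ℝ, y = d' * q - T q}}) (M : ℝ) :
    (∃ a < 0, M < d * a - T a) ∧ ∃ b > 0, M < d * b - T b := by
  obtain ⟨ε, hε, hball⟩ := Metric.mem_nhds_iff.1 (mem_interior_iff_mem_nhds.1 hd)
  have hmem : ∀ e, |e| < ε → ∃ C, ∀ q, C ≤ (d + e) * q - T q := by
    intro e he
    obtain ⟨C, hC⟩ := hball (show d + e ∈ Metric.ball d ε by simpa [Real.dist_eq] using he)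
    exact ⟨C, fun q => hC ⟨q, rfl⟩⟩
  obtain ⟨C₁, h₁⟩ := hmem (ε / 2) (by rw [abs_of_pos (by linarith)]; linarith)
  obtain ⟨C₂, h₂⟩ := hmem (-(ε / 2)) (by rw [abs_neg, abs_of_pos (by linarith)]; linarith)
  have hlarge : ∀ C : ℝ, ∃ r > 0, M < C + ε / 2 * r := by
    intro C
    refine ⟨(|M - C| + 1) / (ε / 2), by positivity, ?_⟩
    rw [mul_div_cancel₀ _ (by positivity)]
    linarith [le_abs_self (M - C)]
  obtain ⟨r, hr, hr'⟩ := hlarge C₁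
  obtain ⟨s, hs, hs'⟩ := hlarge C₂
  refine ⟨⟨-r, by linarith, ?_⟩, s, hs, ?_⟩
  · linarith [h₁ (-r)]
  · linarith [h₂ s]

/-- The Legendre transform `T^*(d) = inf_{q∈ℝ} {dq − T(q)}` (as a real number;
the infimum is genuine at every point of the domain of `T^*`, i.e. wherever the
set `{dq − T(q) : q ∈ ℝ}` is bounded below). -/
noncomputable def legendre (T : ℝ → ℝ) (d : ℝ) : ℝ := sInf {y | ∃ q, y = d * q - T q}

/-- If `T̃ : ℝ → ℝ` is concave and `(T̃_i)` are differentiable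
concave functions converging pointwise to `T̃`, then `T̃_i^* → T̃^*` pointwise on the
interior of the domain of `T̃^*`. -/
theorem legendre_transform_pointwise_convergence
    (T : ℝ → ℝ) (hT : ConcaveOn ℝ Set.univ T)
    (Ti : ℕ → ℝ → ℝ)
    (hTic : ∀ i, ConcaveOn ℝ Set.univ (Ti i))
    (hTid : ∀ i, Differentiable ℝ (Ti i))
    (hconv : ∀ q : ℝ, Tendsto (fun i => Ti i q) atTop (nhds (T q)))
    (d : ℝ)
    (hd : d ∈ interior {d' : ℝ | BddBelow {y | ∃ q : ℝ, y = d' * q - T q}}) :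
    Tendsto (fun i => legendre (Ti i) d) atTop (nhds (legendre T d)) := by
  have hF : ∀ i, ConvexOn ℝ Set.univ (fun q => d * q - Ti i q) := fun i =>
    ((LinearMap.mulLeft ℝ d).convexOn convex_univ).sub (hTic i)
  have hFG : ∀ q, Tendsto (fun i => d * q - Ti i q) atTop (nhds (d * q - T q)) :=
    fun q => (hconv q).const_sub _
  obtain ⟨⟨a, ha, haM⟩, b, hb, hbM⟩ :=
    exists_lt_of_mem_interior_legendre_domain hd (d * 0 - T 0)
  have hlower : ∀ c, (∀ q, c < d * q - T q) → ∀ᶠ i in atTop, ∀ q, c < d * q - Ti i q :=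
    fun c hc => ConvexOn.eventually_forall_lt hF hFG ha hb haM hbM hc
  have hbdd : BddBelow {y | ∃ q : ℝ, y = d * q - T q} :=
    (interior_subset hd :)
  have hle : ∀ q, legendre T d ≤ d * q - T q := fun q => csInf_le hbdd ⟨q, rfl⟩
  have hne : ∀ S : ℝ → ℝ, {y | ∃ q : ℝ, y = d * q - S q}.Nonempty := fun S => ⟨_, 0, rfl⟩
  refine tendsto_order.2 ⟨fun c hc => ?_, fun c hc => ?_⟩
  · obtain ⟨c', hcc', hc'⟩ := exists_between hc
    filter_upwards [hlower c' fun q => hc'.trans_le (hle q)] with i hi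
    refine hcc'.trans_le (le_csInf (hne _) ?_)
    rintro _ ⟨q, rfl⟩
    exact (hi q).le
  · obtain ⟨_, ⟨q, rfl⟩, hq⟩ := exists_lt_of_csInf_lt (hne T) hc
    filter_upwards [hlower (legendre T d - 1) fun q => (sub_one_lt _).trans_le (hle q),
      (hFG q).eventually_lt_const hq] with i hi hiq
    have hbddi : BddBelow {y | ∃ q : ℝ, y = d * q - Ti i q} := by
      refine ⟨legendre T d - 1, ?_⟩
      rintro _ ⟨r, rfl⟩
      exact (hi r).le
    exact (csInf_le hbddi ⟨q, rfl⟩).trans_lt hiq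
end

section
/- Let (Ω,𝓕,ℙ) be a probability space with σ an ergodic ℙ-preserving map. Let (v_n)_{n≥1} be measurable functions v_n : Ω → [0,∞) such that v_n → 0 ℙ-almost surely as n → ∞ and v_n ≤ V for all n, where V ∈ L¹(ℙ). Then for ℙ-almost every ω, (1/n) Σ_{i=0}^{n−1} v_{n−i}(σ^i ω) → 0 as n → ∞. (Applied to v_n = var_n Φ, this gives V_nΦ(ω) := Σ_{i=0}^{n−1} var_{n−i}Φ(σ^iω) = o(n) ℙ-almost surely.) -/
open MeasureTheory Filter

/-- The maximum of `0` and the first `n` Birkhoff sums of `f`, defined by its recursion. -/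
noncomputable def maximalBirkhoffSum {Ω : Type*} (σ : Ω → Ω) (f : Ω → ℝ) : ℕ → Ω → ℝ
  | 0 => fun _ => 0
  | n + 1 => fun ω => max 0 (f ω + maximalBirkhoffSum σ f n (σ ω))

section MaximalBirkhoffSum

variable {Ω : Type*} {σ : Ω → Ω} {f : Ω → ℝ}

lemma maximalBirkhoffSum_nonneg (n : ℕ) (ω : Ω) : 0 ≤ maximalBirkhoffSum σ f n ω := by
  cases n with
  | zero => exact le_rfl
  | succ n => exact le_max_left _ _

lemma maximalBirkhoffSum_le_succ (n : ℕ) (ω : Ω) :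
    maximalBirkhoffSum σ f n ω ≤ maximalBirkhoffSum σ f (n + 1) ω := by
  induction n generalizing ω with
  | zero => exact maximalBirkhoffSum_nonneg _ _
  | succ n ih => exact max_le_max le_rfl (add_le_add le_rfl (ih (σ ω)))

lemma birkhoffSum_le_maximalBirkhoffSum (n : ℕ) (ω : Ω) :
    birkhoffSum σ f n ω ≤ maximalBirkhoffSum σ f n ω := by
  induction n generalizing ω with
  | zero => simp [maximalBirkhoffSum]
  | succ n ih =>
    rw [birkhoffSum_succ']
    exact le_max_of_le_right (add_le_add le_rfl (ih (σ ω)))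

variable [MeasurableSpace Ω] {P : Measure Ω}

lemma integrable_maximalBirkhoffSum (hσ : MeasurePreserving σ P P) (hf : Integrable f P) (n : ℕ) :
    Integrable (maximalBirkhoffSum σ f n) P := by
  induction n with
  | zero => exact integrable_zero _ _ _
  | succ n ih => exact (integrable_zero _ _ _).sup (hf.add (hσ.integrable_comp_of_integrable ih))

/-- The weak-type maximal inequality for finitely many Birkhoff sums. -/
lemma mul_measureReal_maximalBirkhoffSum_pos_le [IsFiniteMeasure P]
    (hσ : MeasurePreserving σ P P) {h : Ω → ℝ} (hh : Integrable h P) (h_nonneg : ∀ ω, 0 ≤ h ω)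
    (c : ℝ) (n : ℕ) :
    c * P.real {ω | 0 < maximalBirkhoffSum σ (fun ω => h ω - c) n ω} ≤ ∫ ω, h ω ∂P := by
  set F := maximalBirkhoffSum σ (fun ω => h ω - c) with hF
  have hfi : Integrable (fun ω => h ω - c) P := hh.sub (integrable_const c)
  have hFi : Integrable (F n) P := integrable_maximalBirkhoffSum hσ hfi n
  have hFσ : Integrable (fun ω => F n (σ ω)) P := hσ.integrable_comp_of_integrable hFi
  set E := {ω | 0 < F n ω} with hE
  have hEm : NullMeasurableSet E P := nullMeasurableSet_lt aemeasurable_const hFi.aemeasurable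
  have hEi : Integrable (E.indicator fun _ => c) P := (integrable_const c).indicator₀ hEm
  have hpt : ∀ ω, F n ω - F n (σ ω) ≤ h ω - E.indicator (fun _ => c) ω := by
    intro ω
    by_cases hω : ω ∈ E
    · rw [Set.indicator_of_mem hω]
      have hpos : 0 < F n ω := hω
      cases n with
      | zero => exact absurd hpos (lt_irrefl _)
      | succ n =>
        have hmax : F (n + 1) ω = max 0 (h ω - c + F n (σ ω)) := rfl
        have hmono : F n (σ ω) ≤ F (n + 1) (σ ω) := maximalBirkhoffSum_le_succ n (σ ω)
        rcases max_choice 0 (h ω - c + F n (σ ω)) with h1 | h1 <;> linarith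
    · rw [Set.indicator_of_notMem hω]
      have hneg : F n ω ≤ 0 := not_lt.mp hω
      have := maximalBirkhoffSum_nonneg (σ := σ) (f := fun ω => h ω - c) n (σ ω)
      have := h_nonneg ω
      linarith
  have hint := integral_mono (hFi.sub hFσ) (hh.sub hEi) hpt
  simp only [Pi.sub_apply] at hint
  rw [integral_sub hFi hFσ, integral_sub hh hEi, integral_indicator₀ hEm, setIntegral_const,
    smul_eq_mul] at hint
  have hinv : ∫ ω, F n (σ ω) ∂P = ∫ ω, F n ω ∂P := by
    have hmap := integral_map (μ := P) hσ.aemeasurable (f := F n)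
      (by rw [hσ.map_eq]; exact hFi.aestronglyMeasurable)
    rw [hσ.map_eq] at hmap
    exact hmap.symm
  linarith

/-- The weak-type maximal ergodic inequality. -/
lemma measure_exists_lt_birkhoffSum_le [IsFiniteMeasure P]
    (hσ : MeasurePreserving σ P P) {h : Ω → ℝ} (hh : Integrable h P) (h_nonneg : ∀ ω, 0 ≤ h ω)
    {c : ℝ} (hc : 0 < c) :
    P {ω | ∃ n : ℕ, n * c < birkhoffSum σ h n ω} ≤ ENNReal.ofReal ((∫ ω, h ω ∂P) / c) := by
  set E : ℕ → Set Ω := fun n => {ω | 0 < maximalBirkhoffSum σ (fun ω => h ω - c) n ω} with hE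
  have hmono : Monotone E :=
    monotone_nat_of_le_succ fun n ω hω => lt_of_lt_of_le hω (maximalBirkhoffSum_le_succ n ω)
  have hsub : {ω | ∃ n : ℕ, n * c < birkhoffSum σ h n ω} ⊆ ⋃ n, E n := by
    rintro ω ⟨n, hn⟩
    refine Set.mem_iUnion.mpr ⟨n, lt_of_lt_of_le ?_ (birkhoffSum_le_maximalBirkhoffSum n ω)⟩
    simpa [birkhoffSum, Finset.sum_sub_distrib] using hn
  refine (measure_mono hsub).trans ?_
  rw [hmono.measure_iUnion]
  refine iSup_le fun n => ?_
  rw [← ofReal_measureReal]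
  refine ENNReal.ofReal_le_ofReal ((le_div_iff₀ hc).mpr ?_)
  rw [mul_comm]
  exact mul_measureReal_maximalBirkhoffSum_pos_le hσ hh h_nonneg c n

end MaximalBirkhoffSum

lemma tendsto_div_nat_of_forall_le_add {u : ℕ → ℝ} (hu : ∀ n, 0 ≤ u n)
    (h : ∀ m : ℕ, ∃ C : ℝ, ∀ n : ℕ, u n ≤ n * (1 / (m + 1 : ℝ)) + C) :
    Tendsto (fun n => u n / n) atTop (nhds 0) := by
  rw [Metric.tendsto_atTop]
  intro ε hε
  obtain ⟨m, hm⟩ := exists_nat_one_div_lt (half_pos hε)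
  obtain ⟨C, hC⟩ := h m
  obtain ⟨N, hN⟩ := exists_nat_gt (C / (ε / 2))
  refine ⟨N + 1, fun n hn => ?_⟩
  have hNn : (N : ℝ) + 1 ≤ n := by exact_mod_cast hn
  have hn0 : (0 : ℝ) < n := by linarith [Nat.cast_nonneg (α := ℝ) N]
  rw [Real.dist_eq, sub_zero, abs_of_nonneg (div_nonneg (hu n) hn0.le), div_lt_iff₀ hn0]
  rw [div_lt_iff₀ (half_pos hε)] at hN
  nlinarith [hC n, mul_lt_mul_of_pos_left hm hn0]

/-- A sequence dominated by an integrable function and tending to `0` almost everywhere is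
controlled, uniformly up to constants, by functions with small integral. -/
lemma exists_dominating_seq {Ω : Type*} [MeasurableSpace Ω] {P : Measure Ω} [IsFiniteMeasure P]
    {v : ℕ → Ω → ℝ} (hmeas : ∀ n, Measurable (v n)) (hnn : ∀ n ω, 0 ≤ v n ω)
    {V : Ω → ℝ} (hV : Integrable V P) (hle : ∀ n ω, v n ω ≤ V ω)
    (h0 : ∀ᵐ ω ∂P, Tendsto (fun n => v n ω) atTop (nhds 0)) :
    ∃ h : ℕ → Ω → ℝ, (∀ N, Integrable (h N) P) ∧ (∀ N ω, 0 ≤ h N ω) ∧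
      (∀ N k ω, v k ω ≤ h N ω + if k < N then (N : ℝ) else 0) ∧
      Tendsto (fun N => ∫ ω, h N ω ∂P) atTop (nhds 0) := by
  have hV0 : ∀ ω, 0 ≤ V ω := fun ω => (hnn 0 ω).trans (hle 0 ω)
  set g : ℕ → Ω → ℝ := fun N ω => ⨆ k, v (N + k) ω with hg
  have hbdd : ∀ N ω, BddAbove (Set.range fun k => v (N + k) ω) := fun N ω =>
    ⟨V ω, by rintro _ ⟨k, rfl⟩; exact hle _ _⟩
  have hg0 : ∀ N ω, 0 ≤ g N ω := fun N ω => Real.iSup_nonneg fun k => hnn _ _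
  have hgV : ∀ N ω, g N ω ≤ V ω := fun N ω => ciSup_le fun k => hle _ _
  have hgm : ∀ N, Measurable (g N) := fun N => Measurable.iSup fun k => hmeas _
  have hgi : ∀ N, Integrable (g N) P := fun N =>
    hV.mono' (hgm N).aestronglyMeasurable <| ae_of_all _ fun ω => by
      rw [Real.norm_eq_abs, abs_of_nonneg (hg0 N ω)]; exact hgV N ω
  have hti : ∀ N : ℕ, Integrable (fun ω => max (V ω - N) 0) P := fun N =>
    (hV.sub (integrable_const _)).sup (integrable_zero _ _ _)
  have hhi : ∀ N : ℕ, Integrable (fun ω => g N ω + max (V ω - N) 0) P :=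
    fun N => (hgi N).add (hti N)
  have hh0 : ∀ (N : ℕ) ω, 0 ≤ g N ω + max (V ω - N) 0 := fun N ω =>
    add_nonneg (hg0 N ω) (le_max_right _ _)
  refine ⟨fun N ω => g N ω + max (V ω - N) 0, hhi, hh0, ?_, ?_⟩
  · intro N k ω
    split_ifs with hk
    · linarith [hle k ω, hg0 N ω, le_max_left (V ω - N) 0]
    · have hvg : v (N + (k - N)) ω ≤ g N ω := le_ciSup (hbdd N ω) (k - N)
      rw [Nat.add_sub_cancel' (not_lt.mp hk)] at hvg
      linarith [le_max_right (V ω - N) 0]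
  · suffices hlim : Tendsto (fun N : ℕ => ∫ ω, (g N ω + max (V ω - N) 0) ∂P) atTop
        (nhds (∫ _, (0 : ℝ) ∂P)) by
      rwa [integral_zero] at hlim
    refine tendsto_integral_of_dominated_convergence (fun ω => V ω + V ω)
      (fun N => (hhi N).aestronglyMeasurable) (hV.add hV) (fun N => ae_of_all _ fun ω => ?_) ?_
    · rw [Real.norm_eq_abs, abs_of_nonneg (hh0 N ω)]
      refine add_le_add (hgV N ω) (max_le ?_ (hV0 ω))
      linarith [Nat.cast_nonneg (α := ℝ) N]
    · filter_upwards [h0] with ω hω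
      rw [Metric.tendsto_atTop] at hω ⊢
      intro ε hε
      obtain ⟨M, hM⟩ := hω (ε / 2) (half_pos hε)
      obtain ⟨K, hK⟩ := exists_nat_ge (V ω)
      refine ⟨max M K, fun N hN => ?_⟩
      have hKN : (K : ℝ) ≤ N := by exact_mod_cast (le_max_right M K).trans hN
      rw [Real.dist_eq, sub_zero, abs_of_nonneg (hh0 N ω), max_eq_right (by linarith), add_zero]
      refine (ciSup_le fun k => ?_).trans_lt (half_lt_self hε)
      have hk := hM (N + k) (((le_max_left M K).trans hN).trans (Nat.le_add_right N k))
      rw [Real.dist_eq, sub_zero] at hk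
      exact (le_abs_self _).trans hk.le

lemma sum_range_ite_sub_lt_le (n N : ℕ) :
    (∑ i ∈ Finset.range n, if n - i < N then (N : ℝ) else 0) ≤ N * N := by
  rw [← Finset.sum_filter, Finset.sum_const, nsmul_eq_mul]
  gcongr
  calc ((Finset.range n).filter fun i => n - i < N).card
      ≤ (Finset.range N).card := by
        refine Finset.card_le_card_of_injOn (fun i => n - i) ?_ ?_
        · intro i hi
          simp_all
        · intro i hi j hj hij
          simp at hi hj hij
          omega
    _ = N := Finset.card_range N

/-- (Maker-type ergodic lemma.) If `v_n ≥ 0` are measurable,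
`v_n → 0` a.s., and `v_n ≤ V` with `V ∈ L¹(ℙ)`, then for ℙ-a.e. `ω`,
`(1/n) Σ_{i<n} v_{n−i}(σ^iω) → 0`. -/
theorem maker_type_ergodic_lemma
    {Ω : Type*} [MeasurableSpace Ω] (P : Measure Ω) [IsProbabilityMeasure P]
    (σ : Ω → Ω) (herg : Ergodic σ P)
    (v : ℕ → Ω → ℝ) (hmeas : ∀ n, Measurable (v n))
    (hnn : ∀ n ω, 0 ≤ v n ω)
    (V : Ω → ℝ) (hV : Integrable V P)
    (hle : ∀ n ω, v n ω ≤ V ω)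
    (h0 : ∀ᵐ ω ∂P, Tendsto (fun n => v n ω) atTop (nhds 0)) :
    ∀ᵐ ω ∂P,
      Tendsto (fun n => (∑ i ∈ Finset.range n, v (n - i) (σ^[i] ω)) / n)
        atTop (nhds 0) := by
  obtain ⟨h, hhi, hh0, hvh, hlim⟩ := exists_dominating_seq hmeas hnn hV hle h0
  have hlinear : ∀ m : ℕ, ∀ᵐ ω ∂P, ∃ C : ℝ, ∀ n : ℕ,
      ∑ i ∈ Finset.range n, v (n - i) (σ^[i] ω) ≤ n * (1 / (m + 1 : ℝ)) + C := by
    intro m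
    have hm : (0 : ℝ) < 1 / (m + 1) := by positivity
    have hlim' : Tendsto (fun N => ENNReal.ofReal ((∫ ω, h N ω ∂P) / (1 / (m + 1 : ℝ)))) atTop
        (nhds 0) := by
      simpa using ENNReal.tendsto_ofReal (hlim.div_const (1 / (m + 1 : ℝ)))
    rw [ae_iff]
    refine le_antisymm (ge_of_tendsto' hlim' fun N => ?_) zero_le
    refine (measure_mono fun ω hω => ?_).trans
      (measure_exists_lt_birkhoffSum_le herg.toMeasurePreserving (hhi N) (hh0 N) hm)
    by_contra hcon
    refine hω ⟨N * N, fun n => ?_⟩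
    have hn : birkhoffSum σ (h N) n ω ≤ n * (1 / (m + 1 : ℝ)) :=
      not_lt.mp fun hlt => hcon ⟨n, hlt⟩
    calc ∑ i ∈ Finset.range n, v (n - i) (σ^[i] ω)
        ≤ ∑ i ∈ Finset.range n, (h N (σ^[i] ω) + if n - i < N then (N : ℝ) else 0) :=
          Finset.sum_le_sum fun i _ => hvh N (n - i) (σ^[i] ω)
      _ = birkhoffSum σ (h N) n ω + ∑ i ∈ Finset.range n, if n - i < N then (N : ℝ) else 0 :=
          Finset.sum_add_distrib
      _ ≤ n * (1 / (m + 1 : ℝ)) + N * N := add_le_add hn (sum_range_ite_sub_lt_le n N)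
  filter_upwards [ae_all_iff.mpr hlinear] with ω hω
  exact tendsto_div_nat_of_forall_le_add (fun n => Finset.sum_nonneg fun i _ => hnn _ _) hω
end
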